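/- The function $t \mapsto 1/\cosh(\sqrt{2t})$ (for $t \ge 0$) is completely monotone; equivalently, there exists a probability measure $A$ on $(0,\infty)$ such that $1/\cosh(\sqrt{2t}) = \int_0^\infty e^{-tx}\,dA(x)$ for all $t \ge 0$. -/

import Mathlib

open MeasureTheory

namespace Stmt11Aux

open ProbabilityTheory Filter Topology

/-- coefficients -/
noncomputable def a (n : ℕ) : ℝ := 8 / ((2 * (n : ℝ) + 1) ^ 2 * Real.pi ^ 2)

lemma a_pos (n : ℕ) : 0 < a n := by
  unfold a
  have := Real.pi_pos
  positivity

lemma a_summable : Summable a := by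
  have h : Summable (fun n : ℕ => (8 / Real.pi ^ 2) * (1 / ((n : ℝ) + 1) ^ 2)) := by
    apply Summable.mul_left
    have := (summable_nat_add_iff 1).mpr (Real.summable_one_div_nat_pow.mpr (one_lt_two))
    simpa using this
  refine Summable.of_nonneg_of_le (fun n => (a_pos n).le) (fun n => ?_) h
  unfold a
  have hp := Real.pi_pos
  have hn : (0 : ℝ) ≤ n := Nat.cast_nonneg n
  rw [div_mul_div_comm, mul_one, mul_comm (Real.pi ^ 2)]
  gcongr
  linarith

lemma prod_split (w : ℂ) (n : ℕ) :
    ∏ j ∈ Finset.range (2 * n), (1 - (2 * w) ^ 2 / ((j : ℂ) + 1) ^ 2) =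
      (∏ j ∈ Finset.range n, (1 - 4 * w ^ 2 / (2 * (j : ℂ) + 1) ^ 2)) *
      ∏ j ∈ Finset.range n, (1 - w ^ 2 / ((j : ℂ) + 1) ^ 2) := by
  induction n with
  | zero => simp
  | succ n ih =>
    rw [show 2 * (n + 1) = 2 * n + 1 + 1 by ring, Finset.prod_range_succ, Finset.prod_range_succ,
      ih, Finset.prod_range_succ, Finset.prod_range_succ]
    have h1 : (n : ℂ) + 1 ≠ 0 := Nat.cast_add_one_ne_zero n
    have e1 : (2 * w) ^ 2 / (((2 * n : ℕ) : ℂ) + 1) ^ 2 = 4 * w ^ 2 / (2 * (n : ℂ) + 1) ^ 2 := by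
      push_cast; ring
    have e2 : (2 * w) ^ 2 / (((2 * n + 1 : ℕ) : ℂ) + 1) ^ 2 = w ^ 2 / ((n : ℂ) + 1) ^ 2 := by
      push_cast
      rw [show (2 * (n : ℂ) + 1 + 1) = 2 * (n + 1) by ring]
      field_simp
    rw [e1, e2]
    ring

lemma cos_prod (w : ℂ) (hw : Complex.sin (Real.pi * w) ≠ 0) :
    Tendsto (fun n : ℕ => ∏ j ∈ Finset.range n, (1 - 4 * w ^ 2 / (2 * (j : ℂ) + 1) ^ 2)) atTop
      (𝓝 (Complex.cos (Real.pi * w))) := by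
  have h1 := Complex.tendsto_euler_sin_prod w
  have h2 := (Complex.tendsto_euler_sin_prod (2 * w)).comp
    (tendsto_id.const_mul_atTop' (show 0 < 2 by norm_num) : Tendsto (fun n : ℕ => 2 * n) atTop atTop)
  have h3 := (h2.div h1 hw).div_const 2
  have hev : ∀ᶠ n in atTop, (Real.pi * w * ∏ j ∈ Finset.range n, (1 - w ^ 2 / ((j : ℂ) + 1) ^ 2)) ≠ 0 :=
    h1.eventually_ne hw
  have e : Complex.sin (Real.pi * (2 * w)) / Complex.sin (Real.pi * w) / 2
      = Complex.cos (Real.pi * w) := by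
    rw [show (Real.pi : ℂ) * (2 * w) = 2 * (Real.pi * w) by ring, Complex.sin_two_mul]
    field_simp
  rw [e] at h3
  refine h3.congr' ?_
  filter_upwards [hev] with n hn
  simp only [Function.comp, Pi.div_apply]
  rw [prod_split]
  have h4 := left_ne_zero_of_mul hn
  have h5 := right_ne_zero_of_mul hn
  have h6 := left_ne_zero_of_mul h4
  have h7 := right_ne_zero_of_mul h4
  generalize (∏ j ∈ Finset.range n, (1 - w ^ 2 / ((j : ℂ) + 1) ^ 2)) = q at h5 ⊢
  generalize (∏ j ∈ Finset.range n, (1 - 4 * w ^ 2 / (2 * (j : ℂ) + 1) ^ 2)) = p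
  field_simp

lemma cosh_prod {t : ℝ} (ht : 0 ≤ t) :
    Tendsto (fun n : ℕ => ∏ j ∈ Finset.range n, (1 + a j * t)) atTop
      (𝓝 (Real.cosh (Real.sqrt (2 * t)))) := by
  rcases ht.eq_or_lt with rfl | ht
  · simp
  set y := Real.sqrt (2 * t) with hy
  have hy0 : 0 < y := Real.sqrt_pos.mpr (by linarith)
  have hy2 : y ^ 2 = 2 * t := Real.sq_sqrt (by linarith)
  have hpi : (Real.pi : ℂ) ≠ 0 := by exact_mod_cast Real.pi_ne_zero
  have ew : (Real.pi : ℂ) * ((y / Real.pi) * Complex.I) = y * Complex.I := by field_simp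
  have := cos_prod ((y / Real.pi) * Complex.I) (by
    rw [ew, Complex.sin_mul_I, ← Complex.ofReal_sinh]
    have : Real.sinh y ≠ 0 := (Real.sinh_pos_iff.mpr hy0).ne'
    exact mul_ne_zero (Complex.ofReal_ne_zero.mpr this) Complex.I_ne_zero)
  rw [ew, Complex.cos_mul_I, ← Complex.ofReal_cosh] at this
  have h := (Complex.continuous_re.tendsto _).comp this
  rw [Complex.ofReal_re] at h
  refine h.congr (fun n => ?_)
  simp only [Function.comp]
  rw [← Complex.ofReal_re (∏ j ∈ Finset.range n, (1 + a j * t))]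
  congr 1
  push_cast
  refine Finset.prod_congr rfl fun j _ => ?_
  have hy2' : (y : ℂ) ^ 2 = 2 * t := by exact_mod_cast hy2
  have hj : (2 * (j : ℂ) + 1) ≠ 0 := by exact_mod_cast Nat.succ_ne_zero (2 * j)
  rw [mul_pow, Complex.I_sq, div_pow, hy2', a]
  push_cast
  field_simp
  ring

/-- standard exponential law -/
noncomputable abbrev E : Measure ℝ := expMeasure 1

instance : IsProbabilityMeasure E := isProbabilityMeasure_expMeasure one_pos

lemma E_eq : E = volume.withDensity (exponentialPDF 1) := rfl

lemma meas_pdf (r : ℝ) : Measurable (exponentialPDF r) :=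
  (measurable_exponentialPDFReal r).ennreal_ofReal

lemma lintegral_exp {s : ℝ} (hs : -1 < s) :
    ∫⁻ x, ENNReal.ofReal (Real.exp (-s * x)) ∂E = ENNReal.ofReal (1 / (1 + s)) := by
  rw [E_eq, lintegral_withDensity_eq_lintegral_mul _ (meas_pdf 1) (by fun_prop)]
  have hs' : 0 < 1 + s := by linarith
  have : ∀ x, (exponentialPDF 1 * fun x => ENNReal.ofReal (Real.exp (-s * x))) x
      = ENNReal.ofReal (1 / (1 + s)) * exponentialPDF (1 + s) x := by
    intro x
    simp only [Pi.mul_apply, exponentialPDF_eq]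
    split_ifs with h
    · rw [← ENNReal.ofReal_mul (by positivity), ← ENNReal.ofReal_mul (by positivity)]
      congr 1
      rw [one_mul, ← Real.exp_add, ← mul_assoc, one_div_mul_cancel hs'.ne', one_mul]
      ring_nf
    · simp
  simp_rw [this]
  rw [lintegral_const_mul _ (meas_pdf _), lintegral_exponentialPDF_eq_one hs', mul_one]

lemma integral_exp {s : ℝ} (hs : -1 < s) :
    ∫ x, Real.exp (-s * x) ∂E = 1 / (1 + s) := by
  have hs' : 0 < 1 + s := by linarith
  rw [integral_eq_lintegral_of_nonneg_ae (Eventually.of_forall fun x => (Real.exp_pos _).le)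
    (by fun_prop), lintegral_exp hs, ENNReal.toReal_ofReal (by positivity)]

lemma mean_fin : ∫⁻ x, ENNReal.ofReal x ∂E ≠ ⊤ := by
  have h := lintegral_exp (s := -1/2) (by norm_num)
  refine ne_top_of_le_ne_top (b := ENNReal.ofReal 2 * ENNReal.ofReal (1 / (1 + (-1/2)))) ?_ ?_
  · exact ENNReal.mul_ne_top ENNReal.ofReal_ne_top ENNReal.ofReal_ne_top
  · rw [← h, ← lintegral_const_mul _ (by fun_prop)]
    refine lintegral_mono fun x => ?_
    rw [← ENNReal.ofReal_mul (by norm_num)]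
    apply ENNReal.ofReal_le_ofReal
    have := Real.add_one_le_exp (-(-1/2) * x)
    linarith

lemma E_pos : ∀ᵐ x ∂E, 0 < x := by
  rw [E_eq, ae_withDensity_iff (meas_pdf 1)]
  have : ∀ᵐ x : ℝ, x ≠ 0 := by simp [ae_iff]
  filter_upwards [this] with x hx h
  by_contra hneg
  exact h (exponentialPDF_of_neg (lt_of_le_of_ne (not_lt.mp hneg) hx))

/-- product space -/
noncomputable abbrev P : Measure (ℕ → ℝ) := Measure.infinitePi (fun _ : ℕ => E)

/-- the random series -/
noncomputable def S (ω : ℕ → ℝ) : ENNReal := ∑' n, ENNReal.ofReal (a n * ω n)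

lemma S_meas : Measurable S := by
  unfold S
  exact Measurable.tsum fun n => by fun_prop

lemma S_fin : ∀ᵐ ω ∂P, S ω < ⊤ := by
  apply ae_lt_top S_meas
  unfold S
  rw [lintegral_tsum (fun n => Measurable.aemeasurable (by fun_prop))]
  have : ∀ n, ∫⁻ ω, ENNReal.ofReal (a n * ω n) ∂P
      = ENNReal.ofReal (a n) * ∫⁻ x, ENNReal.ofReal x ∂E := by
    intro n
    simp_rw [ENNReal.ofReal_mul (a_pos n).le]
    rw [lintegral_const_mul _ (by fun_prop)]
    congr 1
    exact (measurePreserving_eval_infinitePi (fun _ : ℕ => E) n).lintegral_comp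
      (f := fun x => ENNReal.ofReal x) (by fun_prop)
  simp_rw [this]
  rw [ENNReal.tsum_mul_right]
  refine ENNReal.mul_ne_top ?_ mean_fin
  rw [← ENNReal.ofReal_tsum_of_nonneg (fun n => (a_pos n).le) a_summable]
  exact ENNReal.ofReal_ne_top

lemma coord_pos : ∀ᵐ ω ∂P, ∀ n, 0 < ω n := by
  rw [ae_all_iff]
  intro n
  exact (measurePreserving_eval_infinitePi (fun _ : ℕ => E) n).quasiMeasurePreserving.ae E_pos

lemma S_hasSum : ∀ᵐ ω ∂P, HasSum (fun n => a n * ω n) (S ω).toReal := by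
  filter_upwards [S_fin, coord_pos] with ω h1 h2
  have h3 : ∀ n, (ENNReal.ofReal (a n * ω n)).toReal = a n * ω n := fun n =>
    ENNReal.toReal_ofReal (mul_pos (a_pos n) (h2 n)).le
  have h4 := ENNReal.summable_toReal h1.ne
  unfold S
  rw [ENNReal.tsum_toReal_eq (fun n => ENNReal.ofReal_ne_top)]
  simp_rw [h3] at h4 ⊢
  exact h4.hasSum

lemma S_pos : ∀ᵐ ω ∂P, 0 < (S ω).toReal := by
  filter_upwards [S_hasSum, coord_pos] with ω h1 h2
  exact h1.tsum_eq ▸ h1.summable.tsum_pos (fun n => (mul_pos (a_pos n) (h2 n)).le) 0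
    (mul_pos (a_pos 0) (h2 0))

lemma partial_laplace {t : ℝ} (ht : 0 ≤ t) (N : ℕ) :
    ∫ ω, Real.exp (-t * ∑ n ∈ Finset.range N, a n * ω n) ∂P
      = (∏ n ∈ Finset.range N, (1 + a n * t))⁻¹ := by
  have hind : iIndepFun (fun n (ω : ℕ → ℝ) => a n * ω n) P :=
    iIndepFun_infinitePi (X := fun n x => a n * x) (fun n => by fun_prop)
  have h := hind.mgf_sum (t := -t) (fun n => by fun_prop) (Finset.range N)
  simp only [mgf, Finset.sum_apply] at h
  rw [h, ← Finset.prod_inv_distrib]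
  refine Finset.prod_congr rfl fun n _ => ?_
  have hm := (measurePreserving_eval_infinitePi (fun _ : ℕ => E) n)
  have h2 : ∫ ω, Real.exp (-t * (a n * ω n)) ∂P = ∫ x, Real.exp (-t * (a n * x)) ∂E := by
    conv_rhs => rw [← hm.map_eq]
    rw [integral_map hm.measurable.aemeasurable (by fun_prop)]
  rw [h2]
  have h3 := integral_exp (s := a n * t) (by nlinarith [mul_nonneg (a_pos n).le ht])
  rw [← one_div, ← h3]
  congr 1; ext x; congr 1; ring

lemma laplace {t : ℝ} (ht : 0 ≤ t) :
    ∫ ω, Real.exp (-t * (S ω).toReal) ∂P = 1 / Real.cosh (Real.sqrt (2 * t)) := by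
  have h1 : Tendsto (fun N : ℕ => ∫ ω, Real.exp (-t * ∑ n ∈ Finset.range N, a n * ω n) ∂P) atTop
      (𝓝 (∫ ω, Real.exp (-t * (S ω).toReal) ∂P)) := by
    refine tendsto_integral_of_dominated_convergence (fun _ => 1) (fun N => Measurable.aestronglyMeasurable (by fun_prop))
      (integrable_const _) (fun N => ?_) ?_
    · filter_upwards [coord_pos] with ω h
      rw [Real.norm_eq_abs, abs_of_pos (Real.exp_pos _), Real.exp_le_one_iff]
      have : 0 ≤ ∑ n ∈ Finset.range N, a n * ω n :=
        Finset.sum_nonneg fun n _ => (mul_pos (a_pos n) (h n)).le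
      nlinarith
    · filter_upwards [S_hasSum] with ω h
      exact (Real.continuous_exp.tendsto _).comp (h.tendsto_sum_nat.const_mul _)
  have h2 := (cosh_prod ht).inv₀ (Real.cosh_pos _).ne'
  simp_rw [partial_laplace ht] at h1
  rw [one_div]
  exact tendsto_nhds_unique h1 h2

/-- the law -/
noncomputable def A : Measure ℝ := P.map (fun ω => (S ω).toReal)

lemma X_meas : Measurable (fun ω => (S ω).toReal) := S_meas.ennreal_toReal

instance : IsProbabilityMeasure A := Measure.isProbabilityMeasure_map X_meas.aemeasurable

lemma A_pos : ∀ᵐ x ∂A, 0 < x := by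
  rw [A, ae_map_iff X_meas.aemeasurable measurableSet_Ioi]
  exact S_pos

lemma A_laplace {t : ℝ} (ht : 0 ≤ t) :
    ∫ x, Real.exp (-t * x) ∂A = 1 / Real.cosh (Real.sqrt (2 * t)) := by
  rw [A, integral_map X_meas.aemeasurable (by fun_prop), laplace ht]

lemma A_int {t : ℝ} (ht : 0 ≤ t) : Integrable (fun x => Real.exp (-t * x)) A := by
  refine Integrable.mono' (integrable_const (1 : ℝ)) (by fun_prop) ?_
  filter_upwards [A_pos] with x hx
  rw [Real.norm_eq_abs, abs_of_pos (Real.exp_pos _), Real.exp_le_one_iff]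
  nlinarith

lemma cm (φ : ℝ → ℝ) (hφ : ∀ t, φ t = 1 / Real.cosh (Real.sqrt (2 * t))) (k : ℕ) (t : ℝ)
    (ht : 0 < t) : 0 ≤ (-1 : ℝ) ^ k * iteratedDeriv k φ t := by
  have h1 : φ =ᶠ[𝓝 t] fun s => mgf id A (-s) := by
    filter_upwards [lt_mem_nhds ht] with s hs
    rw [hφ, ← A_laplace hs.le]
    rfl
  have h2 : -t ∈ interior (integrableExpSet id A) := by
    rw [mem_interior_iff_mem_nhds]
    filter_upwards [gt_mem_nhds (show -t < 0 by linarith)] with s hs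
    have := A_int (t := -s) (by linarith)
    simpa [integrableExpSet] using this
  rw [h1.iteratedDeriv_eq, iteratedDeriv_comp_neg, iteratedDeriv_mgf h2, smul_eq_mul, ← mul_assoc,
    ← mul_pow]
  norm_num
  refine integral_nonneg_of_ae ?_
  filter_upwards [A_pos] with x hx
  simp only [Pi.zero_apply]
  positivity

end Stmt11Aux

/-- `t ↦ 1/cosh(√(2t))` is completely monotone on `(0,∞)`; equivalently it is the
Laplace transform of a probability measure on `(0,∞)`. -/
theorem stmt11 (φ : ℝ → ℝ) (hφ : ∀ t, φ t = 1 / Real.cosh (Real.sqrt (2 * t))) :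
    (∀ k : ℕ, ∀ t : ℝ, 0 < t → 0 ≤ (-1 : ℝ) ^ k * iteratedDeriv k φ t) ∧
    ∃ A : Measure ℝ, IsProbabilityMeasure A ∧ A (Set.Ioi (0 : ℝ))ᶜ = 0 ∧
      ∀ t : ℝ, 0 ≤ t → ∫ x, Real.exp (-t * x) ∂A = 1 / Real.cosh (Real.sqrt (2 * t)) :=
  ⟨Stmt11Aux.cm φ hφ, Stmt11Aux.A, inferInstance, Stmt11Aux.A_pos,
    fun _ ht => Stmt11Aux.A_laplace ht⟩
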